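/- Under the maximal gap condition δ = max_j (x_{j+1}−x_j) < 1/M with weights w_j = (x_{j+1}−x_{j−1})/2, the condition number of A = V^T V satisfies κ(A) ≤ (1+δM)²/(1−δM)². -/

import Mathlib

open Real Matrix

/-- Wirtinger's inequality with the free endpoint strictly inside a quarter period. -/
lemma wirtinger_left_of_lt {f f' : ℝ → ℝ} (hf : ∀ t, HasDerivAt f (f' t) t)
    (hf' : Continuous f') {a b β : ℝ} (hab : a ≤ b) (hβ : 0 ≤ β) (hβab : β * (b - a) < π / 2)
    (ha : f a = 0) : β ^ 2 * ∫ t in a..b, f t ^ 2 ≤ ∫ t in a..b, f' t ^ 2 := by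
  have hfc : Continuous f := continuous_iff_continuousAt.2 fun t => (hf t).continuousAt
  have hcos : ∀ t ∈ Set.uIcc a b, cos (β * (b - t)) ≠ 0 := by
    intro t ht
    rw [Set.uIcc_of_le hab] at ht
    have h0 : 0 ≤ β * (b - t) := mul_nonneg hβ (by linarith [ht.2])
    have h1 : β * (b - t) ≤ β * (b - a) := by
      apply mul_le_mul_of_nonneg_left _ hβ
      linarith [ht.1]
    exact (cos_pos_of_mem_Ioo ⟨by linarith [pi_pos], by linarith⟩).ne'
  have htan : ContinuousOn (fun t => tan (β * (b - t))) (Set.uIcc a b) := by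
    intro t ht
    exact ((continuousAt_tan.2 (hcos t ht)).comp (f := fun t => β * (b - t))
      (by fun_prop)).continuousWithinAt
  have hderiv : ∀ t ∈ Set.uIcc a b, HasDerivAt (fun t => β * f t ^ 2 * tan (β * (b - t)))
      (2 * β * f t * f' t * tan (β * (b - t))
        - β ^ 2 * f t ^ 2 * (1 + tan (β * (b - t)) ^ 2)) t := by
    intro t ht
    have hinner : HasDerivAt (fun t => β * (b - t)) (-β) t := by
      simpa using ((hasDerivAt_id t).const_sub b).const_mul β
    have h1 := (hasDerivAt_tan (hcos t ht)).comp t hinner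
    have h2 := (((hf t).pow 2).const_mul β).mul h1
    have hsec : 1 / cos (β * (b - t)) ^ 2 = 1 + tan (β * (b - t)) ^ 2 := by
      rw [one_div, ← inv_one_add_tan_sq (hcos t ht), inv_inv]
    refine h2.congr_deriv ?_
    simp only [Function.comp_apply, hsec, Pi.pow_apply]
    push_cast
    ring
  have hint : ContinuousOn (fun t => 2 * β * f t * f' t * tan (β * (b - t))
        - β ^ 2 * f t ^ 2 * (1 + tan (β * (b - t)) ^ 2)) (Set.uIcc a b) := by
    fun_prop
  have hftc := intervalIntegral.integral_eq_sub_of_hasDerivAt hderiv hint.intervalIntegrable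
  have hsub : (∫ t in a..b, (f' t ^ 2 - β ^ 2 * f t ^ 2)) =
      (∫ t in a..b, f' t ^ 2) - β ^ 2 * ∫ t in a..b, f t ^ 2 := by
    rw [intervalIntegral.integral_sub, intervalIntegral.integral_const_mul]
    all_goals exact Continuous.intervalIntegrable (by fun_prop) _ _
  have hmono : (∫ t in a..b, (2 * β * f t * f' t * tan (β * (b - t))
        - β ^ 2 * f t ^ 2 * (1 + tan (β * (b - t)) ^ 2)))
      ≤ ∫ t in a..b, (f' t ^ 2 - β ^ 2 * f t ^ 2) := by
    refine intervalIntegral.integral_mono_on hab hint.intervalIntegrable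
      (Continuous.intervalIntegrable (by fun_prop) _ _) fun t _ => ?_
    nlinarith [sq_nonneg (f' t - β * f t * tan (β * (b - t)))]
  rw [hftc, hsub] at hmono
  simp only [sub_self, mul_zero, tan_zero, ha] at hmono
  nlinarith

/-- Wirtinger's inequality for a function vanishing at the left endpoint. -/
lemma wirtinger_left {f f' : ℝ → ℝ} (hf : ∀ t, HasDerivAt f (f' t) t)
    (hf' : Continuous f') {a b β : ℝ} (hab : a ≤ b) (hβ : 0 < β) (hβab : β * (b - a) ≤ π / 2)
    (ha : f a = 0) : β ^ 2 * ∫ t in a..b, f t ^ 2 ≤ ∫ t in a..b, f' t ^ 2 := by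
  have hlim : Filter.Tendsto (fun γ : ℝ => γ ^ 2 * ∫ t in a..b, f t ^ 2) (nhdsWithin β (Set.Iio β))
      (nhds (β ^ 2 * ∫ t in a..b, f t ^ 2)) :=
    (Continuous.tendsto (by fun_prop) β).mono_left nhdsWithin_le_nhds
  refine le_of_tendsto hlim ?_
  filter_upwards [Ioo_mem_nhdsLT hβ] with γ hγ
  rcases hab.eq_or_lt with rfl | hlt
  · simp
  · refine wirtinger_left_of_lt hf hf' hab hγ.1.le (lt_of_lt_of_le ?_ hβab) ha
    exact mul_lt_mul_of_pos_right hγ.2 (by linarith)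

/-- Wirtinger's inequality for a function vanishing at the right endpoint. -/
lemma wirtinger_right {f f' : ℝ → ℝ} (hf : ∀ t, HasDerivAt f (f' t) t)
    (hf' : Continuous f') {a b β : ℝ} (hab : a ≤ b) (hβ : 0 < β) (hβab : β * (b - a) ≤ π / 2)
    (hb : f b = 0) : β ^ 2 * ∫ t in a..b, f t ^ 2 ≤ ∫ t in a..b, f' t ^ 2 := by
  have h := wirtinger_left (f := fun t => f (a + b - t)) (f' := fun t => -f' (a + b - t))
    (fun t => by
      exact ((hf (a + b - t)).comp t ((hasDerivAt_id t).const_sub (a + b))).congr_deriv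
        (by ring))
    (by fun_prop) hab hβ hβab (by simpa using hb)
  simp only [neg_sq] at h
  rw [intervalIntegral.integral_comp_sub_left (fun t => f t ^ 2),
    intervalIntegral.integral_comp_sub_left (fun t => f' t ^ 2)] at h
  simpa using h

/-- A constant approximating `f` in mean square has comparable mean square. -/
lemma const_sq_bounds {f : ℝ → ℝ} (hf : Continuous f) {a b c d E : ℝ} (hab : a ≤ b)
    (hd : 0 < d) (hd1 : d < 1) (hE : ∫ t in a..b, (f t - c) ^ 2 ≤ E) :
    (1 - d) * (∫ t in a..b, f t ^ 2) - (1 / d - 1) * E ≤ (b - a) * c ^ 2 ∧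
    (b - a) * c ^ 2 ≤ (1 + d) * (∫ t in a..b, f t ^ 2) + (1 + 1 / d) * E := by
  have key : ∀ u v : ℝ, (∫ t in a..b, (u * f t ^ 2 + v * (f t - c) ^ 2)) =
      u * (∫ t in a..b, f t ^ 2) + v * ∫ t in a..b, (f t - c) ^ 2 := by
    intro u v
    rw [intervalIntegral.integral_add, intervalIntegral.integral_const_mul,
      intervalIntegral.integral_const_mul]
    all_goals exact Continuous.intervalIntegrable (by fun_prop) _ _
  have hc : (∫ _ in a..b, c ^ 2) = (b - a) * c ^ 2 := by simp
  have hinv : 1 < 1 / d := by rwa [lt_div_iff₀ hd, one_mul]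
  have hdd : d * (1 / d) = 1 := by field_simp
  have hmul : ∀ y z : ℝ, 0 ≤ d * y ^ 2 + 2 * y * z + 1 / d * z ^ 2 := by
    intro y z
    have : d * y ^ 2 + 2 * y * z + 1 / d * z ^ 2 = 1 / d * (d * y + z) ^ 2 := by
      field_simp
      ring
    rw [this]
    positivity
  constructor
  · have h : (∫ t in a..b, ((1 - d) * f t ^ 2 + (1 - 1 / d) * (f t - c) ^ 2)) ≤
        ∫ _ in a..b, c ^ 2 := by
      refine intervalIntegral.integral_mono_on hab
        (Continuous.intervalIntegrable (by fun_prop) _ _)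
        (Continuous.intervalIntegrable (by fun_prop) _ _) fun t _ => ?_
      have := hmul (f t) (-(f t - c))
      linarith
    rw [key, hc] at h
    have := mul_le_mul_of_nonneg_left hE (by linarith : 0 ≤ 1 / d - 1)
    linarith
  · have h : (∫ _ in a..b, c ^ 2) ≤
        ∫ t in a..b, ((1 + d) * f t ^ 2 + (1 + 1 / d) * (f t - c) ^ 2) := by
      refine intervalIntegral.integral_mono_on hab
        (Continuous.intervalIntegrable (by fun_prop) _ _)
        (Continuous.intervalIntegrable (by fun_prop) _ _) fun t _ => ?_
      have := hmul (f t) (f t - c)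
      linarith
    rw [key, hc] at h
    have := mul_le_mul_of_nonneg_left hE (by linarith : 0 ≤ 1 + 1 / d)
    linarith

/-- The trapezoidal rule for `f ^ 2` on an interval of length at most `δ`. -/
lemma trapezoid_sq_bounds {f f' : ℝ → ℝ} (hf : ∀ t, HasDerivAt f (f' t) t)
    (hf' : Continuous f') {a b d δ : ℝ} (hab : a ≤ b) (hδ : 0 < δ) (hbδ : b - a ≤ δ)
    (hd : 0 < d) (hd1 : d < 1) :
    (1 - d) * (∫ t in a..b, f t ^ 2) - (1 / d - 1) * ((δ / π) ^ 2 * ∫ t in a..b, f' t ^ 2) ≤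
      (b - a) / 2 * (f a ^ 2 + f b ^ 2) ∧
    (b - a) / 2 * (f a ^ 2 + f b ^ 2) ≤
      (1 + d) * (∫ t in a..b, f t ^ 2) + (1 + 1 / d) * ((δ / π) ^ 2 * ∫ t in a..b, f' t ^ 2) := by
  have hfc : Continuous f := continuous_iff_continuousAt.2 fun t => (hf t).continuousAt
  have hβ : 0 < π / δ := by positivity
  have hscale : ∀ {I J : ℝ}, (π / δ) ^ 2 * I ≤ J → I ≤ (δ / π) ^ 2 * J := by
    intro I J h
    have h1 := mul_le_mul_of_nonneg_left h (sq_nonneg (δ / π))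
    have h2 : (δ / π) ^ 2 * ((π / δ) ^ 2 * I) = I := by
      field_simp
    linarith
  have hlen : ∀ {l : ℝ}, l ≤ δ / 2 → π / δ * l ≤ π / 2 := by
    intro l hl
    calc π / δ * l ≤ π / δ * (δ / 2) := mul_le_mul_of_nonneg_left hl hβ.le
      _ = π / 2 := by field_simp
  set m := (a + b) / 2 with hm
  have hl := const_sq_bounds hfc (by linarith : a ≤ m) hd hd1
    (hscale (wirtinger_left (fun t => (hf t).sub_const (f a)) hf' (by linarith) hβ
      (hlen (by linarith)) (sub_self _)))
  have hr := const_sq_bounds hfc (by linarith : m ≤ b) hd hd1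
    (hscale (wirtinger_right (fun t => (hf t).sub_const (f b)) hf' (by linarith) hβ
      (hlen (by linarith)) (sub_self _)))
  have hadd : ∀ {g : ℝ → ℝ}, Continuous g →
      (∫ t in a..b, g t) = (∫ t in a..m, g t) + ∫ t in m..b, g t := fun hg =>
    (intervalIntegral.integral_add_adjacent_intervals (hg.intervalIntegrable _ _)
      (hg.intervalIntegrable _ _)).symm
  rw [hadd (g := fun t => f t ^ 2) (by fun_prop), hadd (g := fun t => f' t ^ 2) (by fun_prop)]
  have hma : m - a = (b - a) / 2 := by rw [hm]; ring
  have hbm : b - m = (b - a) / 2 := by rw [hm]; ring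
  rw [hma] at hl
  rw [hbm] at hr
  constructor
  · linarith [hl.1, hr.1]
  · linarith [hl.2, hr.2]

/-- The composite trapezoidal rule for `f ^ 2` on nodes with maximal gap `δ`. -/
lemma composite_trapezoid_sq_bounds {f f' : ℝ → ℝ} (hf : ∀ t, HasDerivAt f (f' t) t)
    (hf' : Continuous f') {d δ : ℝ} (hδ : 0 < δ) (hd : 0 < d) (hd1 : d < 1) (y : ℕ → ℝ) (n : ℕ)
    (hy : ∀ j < n, y j ≤ y (j + 1)) (hyδ : ∀ j < n, y (j + 1) - y j ≤ δ) :
    (1 - d) * (∫ t in y 0..y n, f t ^ 2)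
        - (1 / d - 1) * ((δ / π) ^ 2 * ∫ t in y 0..y n, f' t ^ 2) ≤
      ∑ j ∈ Finset.range n, (y (j + 1) - y j) / 2 * (f (y j) ^ 2 + f (y (j + 1)) ^ 2) ∧
    ∑ j ∈ Finset.range n, (y (j + 1) - y j) / 2 * (f (y j) ^ 2 + f (y (j + 1)) ^ 2) ≤
      (1 + d) * (∫ t in y 0..y n, f t ^ 2)
        + (1 + 1 / d) * ((δ / π) ^ 2 * ∫ t in y 0..y n, f' t ^ 2) := by
  have hfc : Continuous f := continuous_iff_continuousAt.2 fun t => (hf t).continuousAt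
  have hadd : ∀ {g : ℝ → ℝ}, Continuous g → (∫ t in y 0..y n, g t) =
      ∑ j ∈ Finset.range n, ∫ t in y j..y (j + 1), g t := fun hg =>
    (intervalIntegral.sum_integral_adjacent_intervals
      (fun _ _ => hg.intervalIntegrable _ _)).symm
  rw [hadd (g := fun t => f t ^ 2) (by fun_prop), hadd (g := fun t => f' t ^ 2) (by fun_prop)]
  simp only [Finset.mul_sum, ← Finset.sum_sub_distrib, ← Finset.sum_add_distrib]
  have h := fun j (hj : j ∈ Finset.range n) =>
    trapezoid_sq_bounds hf hf' (hy j (Finset.mem_range.1 hj)) hδ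
      (hyδ j (Finset.mem_range.1 hj)) hd hd1
  exact ⟨Finset.sum_le_sum fun j hj => (h j hj).1, Finset.sum_le_sum fun j hj => (h j hj).2⟩

/-- Summation by parts turning central-difference weights into trapezoidal ones. -/
lemma sum_central_weights (x G : ℕ → ℝ) (n : ℕ) :
    ∑ j ∈ Finset.range (n + 1), (x (j + 2) - x j) / 2 * G (j + 1) =
      (∑ j ∈ Finset.range n, (x (j + 2) - x (j + 1)) / 2 * (G (j + 1) + G (j + 2)))
        + (x 1 - x 0) / 2 * G 1 + (x (n + 2) - x (n + 1)) / 2 * G (n + 1) := by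
  induction n with
  | zero => simp; ring
  | succ n ih =>
    rw [Finset.sum_range_succ, ih, Finset.sum_range_succ]
    ring

lemma integral_cos_pi_int (m : ℤ) :
    ∫ t in (0 : ℝ)..1, cos (π * m * t) = if m = 0 then 1 else 0 := by
  split_ifs with h
  · simp [h]
  · have hm : π * (m : ℝ) ≠ 0 := mul_ne_zero pi_ne_zero (by exact_mod_cast h)
    rw [intervalIntegral.integral_comp_mul_left (fun t => cos t) hm]
    simp [mul_comm π, sin_int_mul_pi]

lemma integral_cos_mul_cos (k l : ℕ) :
    ∫ t in (0 : ℝ)..1, cos (π * k * t) * cos (π * l * t) =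
      if k = l then (if k = 0 then 1 else 1 / 2) else 0 := by
  have h : ∀ t : ℝ, cos (π * k * t) * cos (π * l * t) =
      1 / 2 * cos (π * ((k - l : ℤ) : ℝ) * t) + 1 / 2 * cos (π * ((k + l : ℤ) : ℝ) * t) := by
    intro t
    push_cast
    rw [show π * ((k : ℝ) - l) * t = π * k * t - π * l * t by ring,
      show π * ((k : ℝ) + l) * t = π * k * t + π * l * t by ring, cos_sub, cos_add]
    ring
  simp only [h]
  rw [intervalIntegral.integral_add, intervalIntegral.integral_const_mul,
    intervalIntegral.integral_const_mul, integral_cos_pi_int, integral_cos_pi_int]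
  · split_ifs <;> first | omega | norm_num
  all_goals exact Continuous.intervalIntegrable (by fun_prop) _ _

lemma integral_sin_mul_sin (k l : ℕ) :
    ∫ t in (0 : ℝ)..1, sin (π * k * t) * sin (π * l * t) =
      if k = l then (if k = 0 then 0 else 1 / 2) else 0 := by
  have h : ∀ t : ℝ, sin (π * k * t) * sin (π * l * t) =
      1 / 2 * cos (π * ((k - l : ℤ) : ℝ) * t) - 1 / 2 * cos (π * ((k + l : ℤ) : ℝ) * t) := by
    intro t
    push_cast
    rw [show π * ((k : ℝ) - l) * t = π * k * t - π * l * t by ring,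
      show π * ((k : ℝ) + l) * t = π * k * t + π * l * t by ring, cos_sub, cos_add]
    ring
  simp only [h]
  rw [intervalIntegral.integral_sub, intervalIntegral.integral_const_mul,
    intervalIntegral.integral_const_mul, integral_cos_pi_int, integral_cos_pi_int]
  · split_ifs <;> first | omega | norm_num
  all_goals exact Continuous.intervalIntegrable (by fun_prop) _ _

/-- Parseval's identity for a finite family of orthogonal functions on `[0, 1]`. -/
lemma integral_sum_sq {n : ℕ} {φ : ℕ → ℝ → ℝ} (hφ : ∀ k, Continuous (φ k)) {q : ℕ → ℝ}
    (horth : ∀ k l, ∫ t in (0 : ℝ)..1, φ k t * φ l t = if k = l then q k else 0)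
    (a : Fin n → ℝ) :
    ∫ t in (0 : ℝ)..1, (∑ k, a k * φ k t) ^ 2 = ∑ k, a k ^ 2 * q k := by
  have h : ∀ t, (∑ k, a k * φ k t) ^ 2 = ∑ k, ∑ l, a k * a l * (φ k t * φ l t) := by
    intro t
    rw [sq, Finset.sum_mul_sum]
    exact Finset.sum_congr rfl fun k _ => Finset.sum_congr rfl fun l _ => by ring
  simp only [h]
  rw [intervalIntegral.integral_finsetSum
    fun k _ => Continuous.intervalIntegrable (by fun_prop) _ _]
  refine Finset.sum_congr rfl fun k _ => ?_
  rw [intervalIntegral.integral_finsetSum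
    fun l _ => Continuous.intervalIntegrable (by fun_prop) _ _]
  simp only [intervalIntegral.integral_const_mul, horth, Fin.val_inj]
  simp [sq]

/-- Bernstein's inequality in mean square for cosine polynomials of degree `M`. -/
lemma cosine_bernstein {M : ℕ} (a : Fin (M + 1) → ℝ) :
    ∫ t in (0 : ℝ)..1, (∑ k, a k * (-(π * (k : ℕ)) * sin (π * (k : ℕ) * t))) ^ 2 ≤
      (π * M) ^ 2 * ∫ t in (0 : ℝ)..1, (∑ k, a k * cos (π * (k : ℕ) * t)) ^ 2 := by
  simp only [← mul_assoc]
  rw [integral_sum_sq (φ := fun k t => cos (π * k * t)) (fun k => by fun_prop)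
      integral_cos_mul_cos a,
    integral_sum_sq (φ := fun k t => sin (π * k * t)) (fun k => by fun_prop)
      integral_sin_mul_sin (fun k => a k * -(π * (k : ℕ))), Finset.mul_sum]
  refine Finset.sum_le_sum fun k _ => ?_
  have hk : ((k : ℕ) : ℝ) ≤ M := by exact_mod_cast Nat.lt_succ_iff.1 k.2
  have hk2 : (π * (k : ℕ)) ^ 2 ≤ (π * M) ^ 2 := by gcongr
  split_ifs with h0
  · rw [mul_zero]
    positivity
  · nlinarith [mul_le_mul_of_nonneg_left hk2 (sq_nonneg (a k))]

/-- An eigenvalue of `VᵀV` is the squared norm of the image of a unit vector. -/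
lemma exists_unit_eigenvalue_eq {m n : Type*} [Fintype m] [Fintype n] [DecidableEq n]
    (V : Matrix m n ℝ) (hA : (Vᵀ * V).IsHermitian) (i : n) :
    ∃ c : n → ℝ, ∑ k, c k ^ 2 = 1 ∧ hA.eigenvalues i = ∑ j, (V *ᵥ c) j ^ 2 := by
  refine ⟨⇑(hA.eigenvectorBasis i), ?_, ?_⟩
  · have h := hA.eigenvectorBasis.orthonormal.1 i
    have h2 := EuclideanSpace.real_norm_sq_eq (hA.eigenvectorBasis i)
    rw [h] at h2
    linarith
  · set c : n → ℝ := ⇑(hA.eigenvectorBasis i) with hc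
    have h := hA.mulVec_eigenvectorBasis i
    have hunit : c ⬝ᵥ c = 1 := by
      have h2 := EuclideanSpace.real_norm_sq_eq (hA.eigenvectorBasis i)
      rw [hA.eigenvectorBasis.orthonormal.1 i] at h2
      simp only [dotProduct, ← sq]
      linarith
    have h3 : c ⬝ᵥ ((Vᵀ * V) *ᵥ c) = hA.eigenvalues i := by
      rw [hc, h, dotProduct_smul, ← hc, hunit]
      simp
    rw [← h3, ← mulVec_mulVec, dotProduct_mulVec, vecMul_transpose]
    simp [dotProduct, sq]

/-- Condition number bound: under the maximal gap condition `δ < 1/M` with weights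
`w_j = (x_{j+1} − x_{j−1})/2`, every pair of eigenvalues `λ_i, λ_j` of the symmetric
matrix `A = VᵀV` satisfies `λ_i ≤ (1+δM)²/(1−δM)² · λ_j`, i.e.
`κ(A) ≤ (1+δM)²/(1−δM)²`. -/
theorem condition_number_bound (M r : ℕ) (x w : ℕ → ℝ) (δ : ℝ) (hr : 1 ≤ r)
    (hmono : ∀ j, 1 ≤ j → j < r → x j < x (j + 1))
    (hx1 : x 1 = 0) (hxr : x r = 1)
    (hx0 : x 0 = -x 1) (hxr1 : x (r + 1) = 2 - x r)
    (hw : ∀ j, 1 ≤ j → j ≤ r → w j = (x (j + 1) - x (j - 1)) / 2)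
    (hδ : ∀ j ≤ r, x (j + 1) - x j ≤ δ)
    (hgap : δ < 1 / M)
    (V : Matrix (Fin r) (Fin (M + 1)) ℝ)
    (hV : ∀ (j : Fin r) (k : Fin (M + 1)),
      V j k = if (k : ℕ) = 0 then Real.sqrt (w ((j : ℕ) + 1)) / Real.sqrt 2
        else Real.sqrt (w ((j : ℕ) + 1)) * Real.cos (Real.pi * k * x ((j : ℕ) + 1)))
    (hA : (Vᵀ * V).IsHermitian) :
    ∀ i j : Fin (M + 1),
      hA.eigenvalues i ≤ (1 + δ * M) ^ 2 / (1 - δ * M) ^ 2 * hA.eigenvalues j := by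
  have hδ0 : 0 ≤ δ := by
    have := hδ 0 (Nat.zero_le r)
    rw [hx0, zero_add, hx1] at this
    linarith
  have hM : 0 < (M : ℝ) := by
    by_contra h
    have h0 : (M : ℝ) = 0 := le_antisymm (not_lt.1 h) M.cast_nonneg
    rw [h0, div_zero] at hgap
    linarith
  have hd1 : δ * M < 1 := (lt_div_iff₀ hM).1 hgap
  obtain ⟨n, rfl⟩ : ∃ n, r = n + 1 := ⟨r - 1, by omega⟩
  have hn : 1 ≤ n := by
    by_contra h
    obtain rfl : n = 0 := by omega
    rw [zero_add, hx1] at hxr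
    exact zero_ne_one hxr
  have hδpos : 0 < δ := by
    have h1 := hmono 1 le_rfl (by omega)
    have h2 := hδ 1 (by omega)
    linarith
  have hd : 0 < δ * M := mul_pos hδpos hM
  have hwnn : ∀ j ≤ n, w (j + 1) = (x (j + 2) - x j) / 2 ∧ 0 ≤ w (j + 1) := by
    intro j hj
    have h := hw (j + 1) (by omega) (by omega)
    rw [Nat.add_sub_cancel] at h
    refine ⟨h, ?_⟩
    have h1 : x j ≤ x (j + 1) := by
      rcases Nat.eq_zero_or_pos j with rfl | hj0
      · rw [hx0, zero_add, hx1]; simp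
      · exact (hmono j hj0 (by omega)).le
    have h2 : x (j + 1) ≤ x (j + 2) := by
      rcases hj.eq_or_lt with rfl | hlt
      · rw [hxr1, hxr]; norm_num
      · exact (hmono (j + 1) (by omega) (by omega)).le
    rw [h]
    linarith
  have main : ∀ i, (1 - δ * M) ^ 2 / 2 ≤ hA.eigenvalues i ∧
      hA.eigenvalues i ≤ (1 + δ * M) ^ 2 / 2 := by
    intro i
    obtain ⟨c, hc, hci⟩ := exists_unit_eigenvalue_eq V hA i
    rw [hci]
    set a : Fin (M + 1) → ℝ := fun k => if (k : ℕ) = 0 then c k / √2 else c k with ha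
    set f : ℝ → ℝ := fun t => ∑ k, a k * cos (π * (k : ℕ) * t) with hf_def
    set f' : ℝ → ℝ := fun t => ∑ k, a k * (-(π * (k : ℕ)) * sin (π * (k : ℕ) * t))
    have hf : ∀ t, HasDerivAt f (f' t) t := by
      intro t
      refine HasDerivAt.fun_sum fun k _ => HasDerivAt.const_mul _ ?_
      have h1 : HasDerivAt (fun t : ℝ => π * (k : ℕ) * t) (π * (k : ℕ)) t := by
        simpa using (hasDerivAt_id t).const_mul (π * ((k : ℕ) : ℝ))
      exact h1.cos.congr_deriv (by ring)
    have hf' : Continuous f' := by fun_prop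
    have hN : ∫ t in (0 : ℝ)..1, f t ^ 2 = 1 / 2 := by
      rw [hf_def, integral_sum_sq (φ := fun k t => cos (π * k * t)) (fun k => by fun_prop)
        integral_cos_mul_cos a]
      refine Eq.trans (Finset.sum_congr rfl fun k _ => (?_ : _ = c k ^ 2 / 2))
        (by rw [← Finset.sum_div, hc])
      simp only [ha]
      split_ifs
      · rw [div_pow, sq_sqrt zero_le_two]; ring
      · ring
    have hD : ∫ t in (0 : ℝ)..1, f' t ^ 2 ≤ (π * M) ^ 2 * (1 / 2) := by
      rw [← hN]
      exact cosine_bernstein a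
    have hsum : ∑ j, (V *ᵥ c) j ^ 2 =
        ∑ j ∈ Finset.range n, (x (j + 2) - x (j + 1)) / 2
          * (f (x (j + 1)) ^ 2 + f (x (j + 2)) ^ 2) := by
      have hrow : ∀ j : Fin (n + 1), (V *ᵥ c) j ^ 2 =
          (x ((j : ℕ) + 2) - x (j : ℕ)) / 2 * f (x ((j : ℕ) + 1)) ^ 2 := by
        intro j
        obtain ⟨h1, h2⟩ := hwnn j (Nat.lt_succ_iff.1 j.2)
        have h3 : (V *ᵥ c) j = √(w ((j : ℕ) + 1)) * f (x ((j : ℕ) + 1)) := by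
          rw [hf_def, mulVec, dotProduct, Finset.mul_sum]
          refine Finset.sum_congr rfl fun k _ => ?_
          simp only [hV, ha]
          split_ifs with h0
          · simp [h0]; ring
          · ring
        rw [h3, mul_pow, sq_sqrt h2, h1]
      simp only [hrow]
      rw [Fin.sum_univ_eq_sum_range
        (fun j => (x (j + 2) - x j) / 2 * f (x (j + 1)) ^ 2) (n + 1),
        sum_central_weights x (fun j => f (x j) ^ 2) n, hx0, hxr1, hxr, hx1]
      norm_num
    obtain ⟨hlo, hup⟩ := composite_trapezoid_sq_bounds hf hf' hδpos hd hd1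
      (fun j => x (j + 1)) n (fun j hj => (hmono (j + 1) (by omega) (by omega)).le)
      (fun j hj => hδ (j + 1) (by omega))
    simp only [zero_add, hx1, hxr, hN] at hlo hup
    have hE : (δ / π) ^ 2 * (∫ t in (0 : ℝ)..1, f' t ^ 2) ≤ (δ * M) ^ 2 / 2 := by
      calc _ ≤ (δ / π) ^ 2 * ((π * M) ^ 2 * (1 / 2)) :=
            mul_le_mul_of_nonneg_left hD (sq_nonneg _)
        _ = _ := by field_simp
    have hinv : 1 < 1 / (δ * M) := by rwa [lt_div_iff₀ hd, one_mul]
    have hdd : 1 / (δ * M) * (δ * M) ^ 2 = δ * M := by field_simp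
    have e1 := mul_le_mul_of_nonneg_left hE (by linarith : 0 ≤ 1 / (δ * M) - 1)
    have e2 := mul_le_mul_of_nonneg_left hE (by linarith : 0 ≤ 1 + 1 / (δ * M))
    rw [hsum]
    constructor
    · refine le_trans ?_ hlo
      linarith
    · refine hup.trans ?_
      linarith
  intro i j
  have hpos : 0 < (1 - δ * M) ^ 2 := pow_pos (by linarith) 2
  calc hA.eigenvalues i ≤ (1 + δ * M) ^ 2 / 2 := (main i).2
    _ = (1 + δ * M) ^ 2 / (1 - δ * M) ^ 2 * ((1 - δ * M) ^ 2 / 2) := by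
      rw [← mul_div_assoc, div_mul_cancel₀ _ hpos.ne']
    _ ≤ _ := mul_le_mul_of_nonneg_left (main j).1 (by positivity)
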